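/- arXiv:2507.17839 — 2 statements merged into one kernel-verified Lean document; each statement's English description precedes it below -/
import Mathlib

section
/- Let ε, η, C be real numbers with ε, η ∈ (0,1) and C > 1, and let τ ∈ (0, εη/(2C)). Then there exists a C² function φ: ℝ → ℝ such that φ(t) = (C/2)t² for t ∈ [-τ, τ], φ ≡ 0 on ℝ \ [-2η, 2η], |φ(t)| < ε and |φ'(t)| < ε for all t, φ'(t) ≥ 0 for t ∈ [0, η], and φ''(t) ∈ (-ε, C] for all t. -/
open Set

/-- The truncated power `x₊²` is differentiable with derivative `2 x₊`. -/
lemma hasDerivAt_max_zero_sq (x : ℝ) :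
    HasDerivAt (fun y : ℝ => max y 0 ^ 2) (2 * max x 0) x := by
  have key : ∀ y : ℝ, y ≠ 0 → HasDerivAt (fun y : ℝ => max y 0 ^ 2) (2 * max y 0) y := by
    intro y hy
    rcases lt_or_gt_of_ne hy with h | h
    · rw [max_eq_right h.le, mul_zero]
      refine (hasDerivAt_const y (0 : ℝ)).congr_of_eventuallyEq ?_
      filter_upwards [eventually_lt_nhds h] with z hz
      simp [max_eq_right hz.le]
    · rw [max_eq_left h.le]
      have h2 : HasDerivAt (fun z : ℝ => z ^ 2) (2 * y) y := by
        simpa using hasDerivAt_pow 2 y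
      refine h2.congr_of_eventuallyEq ?_
      filter_upwards [eventually_gt_nhds h] with z hz
      simp [max_eq_left hz.le]
  by_cases hx : x = 0
  · subst hx
    exact hasDerivAt_of_hasDerivAt_of_ne (g := fun y : ℝ => 2 * max y 0) key
      (by fun_prop) (by fun_prop)
  · exact key x hx

/-- The truncated power `x₊³` is differentiable with derivative `3 x₊²`. -/
lemma hasDerivAt_max_zero_cube (x : ℝ) :
    HasDerivAt (fun y : ℝ => max y 0 ^ 3) (3 * max x 0 ^ 2) x := by
  have h := (hasDerivAt_max_zero_sq x).mul (hasDerivAt_id x)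
  have e : (fun y : ℝ => max y 0 ^ 3) = (fun y : ℝ => max y 0 ^ 2) * id := by
    funext y
    rcases le_total y 0 with hy | hy
    · simp [Pi.mul_apply, max_eq_right hy]
    · simp [Pi.mul_apply, max_eq_left hy, pow_succ]
  rw [e]
  refine h.congr_deriv ?_
  rcases le_total x 0 with hx | hx
  · simp [max_eq_right hx]
  · simp only [max_eq_left hx, id_eq]; ring

/-- The continuous step rising linearly from `0` to `1` on `[a, a + d]`. -/
noncomputable def linStep (d a t : ℝ) : ℝ := (max (t - a) 0 - max (t - a - d) 0) / d

/-- The antiderivative of `linStep d a` vanishing on the left. -/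
noncomputable def linStepInt (d a t : ℝ) : ℝ :=
  (max (t - a) 0 ^ 2 - max (t - a - d) 0 ^ 2) / (2 * d)

/-- The second antiderivative of `linStep d a` vanishing on the left. -/
noncomputable def linStepInt₂ (d a t : ℝ) : ℝ :=
  (max (t - a) 0 ^ 3 - max (t - a - d) 0 ^ 3) / (6 * d)

lemma continuous_linStep (d a : ℝ) : Continuous (linStep d a) := by
  unfold linStep; fun_prop

lemma hasDerivAt_linStepInt (d a t : ℝ) :
    HasDerivAt (linStepInt d a) (linStep d a t) t := by
  have h1 := (hasDerivAt_max_zero_sq (t - a)).comp t ((hasDerivAt_id t).sub_const a)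
  have h2 := (hasDerivAt_max_zero_sq (t - a - d)).comp t
    (((hasDerivAt_id t).sub_const a).sub_const d)
  refine ((h1.sub h2).div_const (2 * d)).congr_deriv ?_
  unfold linStep
  rw [mul_one, mul_one, ← mul_sub, mul_div_mul_left _ _ two_ne_zero]

lemma hasDerivAt_linStepInt₂ (d a t : ℝ) :
    HasDerivAt (linStepInt₂ d a) (linStepInt d a t) t := by
  have h1 := (hasDerivAt_max_zero_cube (t - a)).comp t ((hasDerivAt_id t).sub_const a)
  have h2 := (hasDerivAt_max_zero_cube (t - a - d)).comp t
    (((hasDerivAt_id t).sub_const a).sub_const d)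
  refine ((h1.sub h2).div_const (6 * d)).congr_deriv ?_
  unfold linStepInt
  rw [mul_one, mul_one, ← mul_sub, show 6 * d = 3 * (2 * d) by ring,
    mul_div_mul_left _ _ three_ne_zero]

section
variable {d a t : ℝ}

lemma linStep_of_le (hd : 0 < d) (h : t ≤ a) : linStep d a t = 0 := by
  simp [linStep, max_eq_right (show t - a ≤ 0 by linarith),
    max_eq_right (show t - a - d ≤ 0 by linarith)]

lemma linStep_of_ge (hd : 0 < d) (h : a + d ≤ t) : linStep d a t = 1 := by
  rw [linStep, max_eq_left (show 0 ≤ t - a by linarith),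
    max_eq_left (show 0 ≤ t - a - d by linarith)]
  field_simp; ring

lemma linStep_mem_Icc (hd : 0 < d) : linStep d a t ∈ Icc (0 : ℝ) 1 := by
  rw [linStep, mem_Icc, div_le_one hd]
  refine ⟨div_nonneg (sub_nonneg.2 (max_le_max_right 0 (by linarith))) hd.le, ?_⟩
  rw [sub_le_iff_le_add]
  refine max_le ?_ (by positivity)
  linarith [le_max_left (t - a - d) 0]

lemma linStepInt_of_le (hd : 0 < d) (h : t ≤ a) : linStepInt d a t = 0 := by
  simp [linStepInt, max_eq_right (show t - a ≤ 0 by linarith),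
    max_eq_right (show t - a - d ≤ 0 by linarith)]

lemma linStepInt_of_ge (hd : 0 < d) (h : a + d ≤ t) :
    linStepInt d a t = t - a - d / 2 := by
  rw [linStepInt, max_eq_left (show 0 ≤ t - a by linarith),
    max_eq_left (show 0 ≤ t - a - d by linarith)]
  field_simp; ring

lemma linStepInt_of_mem (h : a ≤ t) (h' : t ≤ a + d) :
    linStepInt d a t = (t - a) ^ 2 / (2 * d) := by
  rw [linStepInt, max_eq_left (show 0 ≤ t - a by linarith),
    max_eq_right (show t - a - d ≤ 0 by linarith)]
  simp

lemma linStepInt_mono (hd : 0 < d) : Monotone (linStepInt d a) := by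
  refine monotone_of_deriv_nonneg
    (fun t => (hasDerivAt_linStepInt d a t).differentiableAt) fun t => ?_
  rw [(hasDerivAt_linStepInt d a t).deriv]
  exact (linStep_mem_Icc hd).1

lemma linStepInt_nonneg (hd : 0 < d) : 0 ≤ linStepInt d a t := by
  rcases le_total t a with h | h
  · rw [linStepInt_of_le hd h]
  · rw [← linStepInt_of_le hd (le_refl a)]
    exact linStepInt_mono hd h

lemma linStepInt_sub (b : ℝ) : linStepInt d b t = linStepInt d a (t - (b - a)) := by
  unfold linStepInt; ring_nf

lemma linStepInt_anti {b : ℝ} (hd : 0 < d) (h : a ≤ b) :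
    linStepInt d b t ≤ linStepInt d a t := by
  rw [linStepInt_sub (a := a) b]
  exact linStepInt_mono hd (by linarith)

lemma linStepInt_le (hd : 0 < d) (h : a ≤ t) : linStepInt d a t ≤ t - a := by
  rcases le_total t (a + d) with h' | h'
  · rw [linStepInt_of_mem h h', div_le_iff₀ (by positivity)]
    nlinarith
  · rw [linStepInt_of_ge hd h']; linarith

lemma linStepInt_ge (hd : 0 < d) : t - a - d / 2 ≤ linStepInt d a t := by
  rcases le_total t a with h | h
  · rw [linStepInt_of_le hd h]; linarith
  rcases le_total t (a + d) with h' | h'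
  · rw [linStepInt_of_mem h h', le_div_iff₀ (by positivity)]
    nlinarith [sq_nonneg (t - a - d)]
  · rw [linStepInt_of_ge hd h']

lemma linStepInt₂_of_le (hd : 0 < d) (h : t ≤ a) : linStepInt₂ d a t = 0 := by
  simp [linStepInt₂, max_eq_right (show t - a ≤ 0 by linarith),
    max_eq_right (show t - a - d ≤ 0 by linarith)]

lemma linStepInt₂_of_ge (hd : 0 < d) (h : a + d ≤ t) :
    linStepInt₂ d a t = (t - a - d / 2) ^ 2 / 2 + d ^ 2 / 24 := by
  rw [linStepInt₂, max_eq_left (show 0 ≤ t - a by linarith),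
    max_eq_left (show 0 ≤ t - a - d by linarith)]
  field_simp; ring

end

/-- A ramp width small enough for all the strict inequalities of the construction. -/
lemma exists_ramp_width {ε η C τ : ℝ} (hε : ε ∈ Ioo (0:ℝ) 1) (hη : η ∈ Ioo (0:ℝ) 1)
    (hC : 1 < C) (hτ : τ ∈ Ioo 0 (ε * η / (2 * C))) :
    ∃ d, 0 < d ∧ 4 * d < η ∧ τ + 2 * d < η ∧ C * (τ + d) < ε ∧
      C * (τ + d / 2) < ε * (η - τ - d) ∧
      C * (τ + d / 2) * (η - d / 2) / 2 < ε * ((η - d) ^ 2 / 4) := by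
  obtain ⟨hε0, hε1⟩ := hε
  obtain ⟨hη0, hη1⟩ := hη
  obtain ⟨hτ0, hτ1⟩ := hτ
  rw [lt_div_iff₀ (by linarith)] at hτ1
  have h1 : ε * η < η := by nlinarith
  have h2 : ε * η < ε := by nlinarith
  have h3 : τ < C * τ := by nlinarith
  have h4 : τ < η / 2 := by nlinarith
  have aux : ∀ f g : ℝ → ℝ, Continuous f → Continuous g → f 0 < g 0 →
      ∀ᶠ d in nhdsWithin (0:ℝ) (Ioi 0), f d < g d := fun f g hf hg h =>
    (hf.continuousAt.eventually_lt hg.continuousAt h).filter_mono nhdsWithin_le_nhds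
  have e1 := aux (fun d => 4 * d) (fun _ => η) (by fun_prop) (by fun_prop) (by linarith)
  have e2 := aux (fun d => τ + 2 * d) (fun _ => η) (by fun_prop) (by fun_prop)
    (by linarith)
  have e3 := aux (fun d => C * (τ + d)) (fun _ => ε) (by fun_prop) (by fun_prop)
    (by nlinarith)
  have e4 := aux (fun d => C * (τ + d / 2)) (fun d => ε * (η - τ - d)) (by fun_prop)
    (by fun_prop) (by nlinarith)
  have e5 := aux (fun d => C * (τ + d / 2) * (η - d / 2) / 2)
    (fun d => ε * ((η - d) ^ 2 / 4)) (by fun_prop) (by fun_prop) (by nlinarith)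
  obtain ⟨d, hd, h⟩ := ((eventually_mem_nhdsWithin (a := (0:ℝ)) (s := Ioi 0)).and
    (e1.and (e2.and (e3.and (e4.and e5))))).exists
  exact ⟨d, hd, h⟩

set_option maxHeartbeats 1000000 in
/-- Existence of the C¹-small cut-off function φ with controlled second derivative. -/
theorem stmt_15 (ε η C τ : ℝ) (hε : ε ∈ Ioo (0:ℝ) 1) (hη : η ∈ Ioo (0:ℝ) 1)
    (hC : 1 < C) (hτ : τ ∈ Ioo 0 (ε * η / (2 * C))) :
    ∃ φ : ℝ → ℝ, ContDiff ℝ 2 φ ∧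
      (∀ t ∈ Icc (-τ) τ, φ t = C / 2 * t ^ 2) ∧
      (∀ t, t ∉ Icc (-(2*η)) (2*η) → φ t = 0) ∧
      (∀ t, |φ t| < ε ∧ |deriv φ t| < ε) ∧
      (∀ t ∈ Icc (0:ℝ) η, 0 ≤ deriv φ t) ∧
      (∀ t, deriv (deriv φ) t ∈ Ioc (-ε) C) := by
  obtain ⟨d, hd, hdη, hdτ, hCd, hs, hσ⟩ := exists_ramp_width hε hη hC hτ
  obtain ⟨hε0, hε1⟩ := hε
  obtain ⟨hη0, hη1⟩ := hη
  replace hτ := hτ.1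
  obtain ⟨s, hsdef⟩ : ∃ s, s = C * (τ + d / 2) / (η - τ - d) := ⟨_, rfl⟩
  have hw : 0 < η - τ - d := by linarith
  have hs_eq : s * (η - τ - d) = C * (τ + d / 2) := by rw [hsdef]; field_simp
  have hs0 : 0 ≤ s := by rw [hsdef]; positivity
  have hsε : s < ε := by rw [hsdef, div_lt_iff₀ hw]; exact hs
  have hM : 0 < (η - d) ^ 2 / 4 := by
    have : 0 < η - d := by linarith
    positivity
  obtain ⟨σ, hσdef⟩ : ∃ σ, σ = (C * (τ + d / 2) * (η - d / 2) / 2 - C * d ^ 2 / 24) /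
    ((η - d) ^ 2 / 4) := ⟨_, rfl⟩
  have hσ_eq : σ * ((η - d) ^ 2 / 4) =
      C * (τ + d / 2) * (η - d / 2) / 2 - C * d ^ 2 / 24 := by
    rw [hσdef, div_mul_cancel₀ _ hM.ne']
  have hσ0 : 0 ≤ σ := by
    rw [hσdef]
    refine div_nonneg ?_ hM.le
    have : d ^ 2 / 12 ≤ (τ + d / 2) * (η - d / 2) := by nlinarith
    nlinarith
  have hσε : σ < ε := by
    rw [hσdef, div_lt_iff₀ hM]
    have : 0 < C * d ^ 2 := by positivity
    linarith
  clear hsdef hσdef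
  -- the one-sided correction and its derivatives, with a generic building block
  let L : (ℝ → ℝ → ℝ) → ℝ → ℝ := fun B t => -(C + s) * B τ t + s * B (η - d) t
    - σ * (B η t - 2 * B (3 * η / 2 - d / 2) t + B (2 * η - d) t)
  have hL : ∀ B t, L B t = -(C + s) * B τ t + s * B (η - d) t
    - σ * (B η t - 2 * B (3 * η / 2 - d / 2) t + B (2 * η - d) t) := fun _ _ => rfl
  have hLd : ∀ (B B' : ℝ → ℝ → ℝ), (∀ a t, HasDerivAt (B a) (B' a t) t) →
      ∀ t, HasDerivAt (L B) (L B' t) t := fun B B' h t =>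
    (((h _ t).const_mul _).add ((h _ t).const_mul _)).sub
      ((((h _ t).sub ((h _ t).const_mul _)).add (h _ t)).const_mul _)
  have hL0 : ∀ (B : ℝ → ℝ → ℝ), (∀ a t, t ≤ a → B a t = 0) → ∀ t ≤ τ, L B t = 0 := by
    intro B hB t ht
    rw [hL, hB _ _ ht, hB (η - d) _ (by linarith), hB η _ (by linarith),
      hB (3 * η / 2 - d / 2) _ (by linarith), hB (2 * η - d) _ (by linarith)]
    ring
  clear_value L
  let φ : ℝ → ℝ := fun t => C / 2 * t ^ 2 + L (linStepInt₂ d) t + L (linStepInt₂ d) (-t)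
  let p : ℝ → ℝ := fun t => C * t + L (linStepInt d) t - L (linStepInt d) (-t)
  let g : ℝ → ℝ := fun t => C + L (linStep d) t + L (linStep d) (-t)
  have hφ : ∀ t, HasDerivAt φ (p t) t := by
    intro t
    have h := hLd _ _ (hasDerivAt_linStepInt₂ d)
    have h2 := (h (-t)).comp t (hasDerivAt_neg t)
    refine ((((hasDerivAt_pow 2 t).const_mul (C / 2)).add (h t)).add h2).congr_deriv ?_
    simp only [p]; push_cast; ring
  have hp : ∀ t, HasDerivAt p (g t) t := by
    intro t
    have h := hLd _ _ (hasDerivAt_linStepInt d)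
    have h2 := (h (-t)).comp t (hasDerivAt_neg t)
    refine ((((hasDerivAt_id t).const_mul C).add (h t)).sub h2).congr_deriv ?_
    simp only [g]; ring
  have hg : Continuous g := by
    have : Continuous (L (linStep d)) := by
      have := continuous_linStep d
      rw [show L (linStep d) = _ from funext (hL _)]
      fun_prop
    fun_prop
  have hdφ : deriv φ = p := funext fun t => (hφ t).deriv
  have hdp : deriv p = g := funext fun t => (hp t).deriv
  have φ_even : ∀ t, φ (-t) = φ t := fun t => by simp only [φ, neg_neg]; ring
  have p_odd : ∀ t, p (-t) = -p t := fun t => by simp only [p, neg_neg]; ring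
  have g_even : ∀ t, g (-t) = g t := fun t => by simp only [g, neg_neg]; ring
  have φ_pos : ∀ t, 0 ≤ t → φ t = C / 2 * t ^ 2 + L (linStepInt₂ d) t := fun t ht => by
    simp only [φ]
    rw [hL0 _ (fun a t => linStepInt₂_of_le hd) (-t) (by linarith), add_zero]
  have p_pos : ∀ t, 0 ≤ t → p t = C * t + L (linStepInt d) t := fun t ht => by
    simp only [p]
    rw [hL0 _ (fun a t => linStepInt_of_le hd) (-t) (by linarith), sub_zero]
  have g_pos : ∀ t, 0 ≤ t → g t = C + L (linStep d) t := fun t ht => by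
    simp only [g]
    rw [hL0 _ (fun a t => linStep_of_le hd) (-t) (by linarith), add_zero]
  clear_value φ p g
  have φ_near : ∀ t, 0 ≤ t → t ≤ τ → φ t = C / 2 * t ^ 2 := fun t h0 ht => by
    rw [φ_pos t h0, hL0 _ (fun a t => linStepInt₂_of_le hd) t ht, add_zero]
  have φ_far : ∀ t, 2 * η ≤ t → φ t = 0 := fun t ht => by
    rw [φ_pos t (by linarith), hL]
    repeat rw [linStepInt₂_of_ge hd (by linarith)]
    linear_combination ((τ + η) / 2 - t) * hs_eq - hσ_eq
  have p_far : ∀ t, 2 * η ≤ t → p t = 0 := fun t ht => by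
    rw [p_pos t (by linarith), hL]
    repeat rw [linStepInt_of_ge hd (by linarith)]
    linear_combination -hs_eq
  have p_left : ∀ t, 0 ≤ t → t ≤ η → 0 ≤ p t ∧ p t < ε := by
    intro t h0 ht
    rw [p_pos t h0, hL, linStepInt_of_le hd ht,
      linStepInt_of_le (a := 3 * η / 2 - d / 2) hd (by linarith),
      linStepInt_of_le (a := 2 * η - d) hd (by linarith)]
    rcases le_total t (τ + d) with h | h
    · rw [linStepInt_of_le (a := η - d) hd (by linarith)]
      have hB := linStepInt_nonneg (a := τ) (t := t) hd
      constructor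
      · rcases le_total t τ with h' | h'
        · rw [linStepInt_of_le hd h']
          have : 0 ≤ C * t := by positivity
          linarith
        · have hB2 : linStepInt d τ t ≤ (t - τ) / 2 := by
            rw [linStepInt_of_mem h' h, div_le_iff₀ (by positivity)]
            nlinarith
          nlinarith
      · nlinarith
    · rw [linStepInt_of_ge hd h]
      have hB := linStepInt_ge (a := η - d) (t := t) hd
      have hB2 : linStepInt d (η - d) t ≤ t - τ - d / 2 := by
        rcases le_total t (η - d) with h' | h'
        · rw [linStepInt_of_le hd h']; linarith
        · have := linStepInt_le hd h'; linarith
      constructor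
      · nlinarith
      · nlinarith
  have p_right : ∀ t, η ≤ t → t ≤ 2 * η → |p t| < ε := by
    intro t ht ht2
    rw [p_pos t (by linarith), hL, linStepInt_of_ge (a := τ) hd (by linarith),
      linStepInt_of_ge (a := η - d) hd (by linarith)]
    have hB1 := linStepInt_le hd ht
    have hB12 := linStepInt_anti (t := t) hd (show η ≤ 3 * η / 2 - d / 2 by linarith)
    have hB23 := linStepInt_anti (t := t) hd
      (show 3 * η / 2 - d / 2 ≤ 2 * η - d by linarith)
    have hB3 := linStepInt_nonneg (a := 2 * η - d) (t := t) hd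
    have e : C * t + (-(C + s) * (t - τ - d / 2) + s * (t - (η - d) - d / 2)
        - σ * (linStepInt d η t - 2 * linStepInt d (3 * η / 2 - d / 2) t
          + linStepInt d (2 * η - d) t)) =
        - (σ * (linStepInt d η t - 2 * linStepInt d (3 * η / 2 - d / 2) t
          + linStepInt d (2 * η - d) t)) := by
      linear_combination -hs_eq
    rw [e, abs_neg, abs_mul, abs_of_nonneg hσ0]
    have hq : |linStepInt d η t - 2 * linStepInt d (3 * η / 2 - d / 2) t
          + linStepInt d (2 * η - d) t| ≤ 1 := by
      rw [abs_le]; constructor <;> linarith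
    nlinarith
  have p_lt : ∀ t, |p t| < ε := by
    have : ∀ t, 0 ≤ t → |p t| < ε := by
      intro t h0
      rcases le_total t η with h | h
      · rw [abs_of_nonneg (p_left t h0 h).1]; exact (p_left t h0 h).2
      rcases le_total t (2 * η) with h' | h'
      · exact p_right t h h'
      · rw [p_far t h']; simpa
    intro t
    rcases le_total 0 t with h | h
    · exact this t h
    · rw [← abs_neg, ← p_odd]; exact this _ (by linarith)
  have φ_lip : ∀ x y, |φ y - φ x| ≤ ε * |y - x| := fun x y =>
    convex_univ.norm_image_sub_le_of_norm_hasDerivWithin_le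
      (fun z _ => (hφ z).hasDerivWithinAt) (fun z _ => (p_lt z).le) (mem_univ x) (mem_univ y)
  have φ_lt : ∀ t, |φ t| < ε := by
    have : ∀ t, 0 ≤ t → |φ t| < ε := by
      intro t h0
      rcases le_total t η with h | h
      · have := φ_lip 0 t
        rw [φ_near 0 le_rfl hτ.le, sub_zero, abs_of_nonneg h0] at this
        simp only [ne_eq, OfNat.ofNat_ne_zero, not_false_eq_true, zero_pow, mul_zero,
          sub_zero] at this
        nlinarith
      rcases le_total t (2 * η) with h' | h'
      · have := φ_lip (2 * η) t
        rw [φ_far _ le_rfl, sub_zero, abs_of_nonpos (show t - 2 * η ≤ 0 by linarith)] at this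
        nlinarith
      · rw [φ_far t h']; simpa
    intro t
    rcases le_total 0 t with h | h
    · exact this t h
    · rw [← φ_even]; exact this _ (by linarith)
  have g_mem : ∀ t, g t ∈ Ioc (-ε) C := by
    have : ∀ t, 0 ≤ t → g t ∈ Ioc (-ε) C := by
      intro t h0
      have aux : ∀ a b, a + d ≤ b → linStep d b t = 0 ∨ linStep d a t = 1 := by
        intro a b hab
        rcases le_total t b with h | h
        · exact Or.inl (linStep_of_le hd h)
        · exact Or.inr (linStep_of_ge hd (by linarith))
      have b1 := linStep_mem_Icc (a := τ) (t := t) hd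
      have b2 := linStep_mem_Icc (a := η - d) (t := t) hd
      have b3 := linStep_mem_Icc (a := η) (t := t) hd
      have b4 := linStep_mem_Icc (a := 3 * η / 2 - d / 2) (t := t) hd
      have b5 := linStep_mem_Icc (a := 2 * η - d) (t := t) hd
      have a1 := aux τ (η - d) (by linarith)
      have a2 := aux (η - d) η (by linarith)
      have a3 := aux η (3 * η / 2 - d / 2) (by linarith)
      have a4 := aux (3 * η / 2 - d / 2) (2 * η - d) (by linarith)
      rw [g_pos t h0, hL]
      generalize linStep d τ t = x1 at *
      generalize linStep d (η - d) t = x2 at *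
      generalize linStep d η t = x3 at *
      generalize linStep d (3 * η / 2 - d / 2) t = x4 at *
      generalize linStep d (2 * η - d) t = x5 at *
      simp only [mem_Icc] at b1 b2 b3 b4 b5
      clear aux
      rcases a1 with rfl | rfl <;> rcases a2 with rfl | h2 <;> rcases a3 with rfl | h3 <;>
        rcases a4 with rfl | h4 <;> (try subst h2) <;> (try subst h3) <;> (try subst h4) <;>
        first
        | (exfalso; linarith)
        | (constructor <;> nlinarith)
    intro t
    rcases le_total 0 t with h | h
    · exact this t h
    · rw [← g_even]; exact this _ (by linarith)
  refine ⟨φ, ?_, ?_, ?_, fun t => ⟨φ_lt t, by rw [hdφ]; exact p_lt t⟩, ?_, ?_⟩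
  · have h1 : ContDiff ℝ 1 p :=
      contDiff_one_iff_deriv.2 ⟨fun t => (hp t).differentiableAt, by rwa [hdp]⟩
    rw [show (2 : WithTop ℕ∞) = 1 + 1 by norm_num, contDiff_succ_iff_deriv]
    exact ⟨fun t => (hφ t).differentiableAt, by simp, by rwa [hdφ]⟩
  · intro t ht
    rcases le_total 0 t with h | h
    · exact φ_near t h ht.2
    · rw [← φ_even, φ_near (-t) (by linarith) (by linarith [ht.1]), neg_sq]
  · intro t ht
    rcases le_total 0 t with h | h
    · refine φ_far t (le_of_lt ?_)
      by_contra! h'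
      exact ht ⟨by linarith, h'⟩
    · rw [← φ_even]
      refine φ_far (-t) (le_of_lt ?_)
      by_contra! h'
      exact ht ⟨by linarith, by linarith⟩
  · intro t ht
    rw [hdφ]; exact (p_left t ht.1 ht.2).1
  · rw [hdφ, hdp]; exact g_mem
end

section
/- Let A: Λ²V → Λ²V be a self-adjoint linear map on the exterior square of a finite-dimensional real inner product space V, with orthogonal splitting V = V₁ ⊕ V₂ ⊕ V₃ such that each Vᵢ∧Vⱼ is an eigenspace of A with eigenvalue λᵢⱼ. Fix k ≤ dim V - 1 and c ∈ ℝ. Suppose for every i ∈ {1,2,3} and all nonnegative integers n_{i1}, n_{i2}, n_{i3} with n_{ij} ≤ dim Vⱼ for j ≠ i, n_{ii} ≤ dim Vᵢ - 1, and n_{i1}+n_{i2}+n_{i3} = k, we have n_{i1}λ_{i1}+n_{i2}λ_{i2}+n_{i3}λ_{i3} > c. Then for every orthonormal set {u₀, u₁, ..., u_k} in V, ∑_{i=1}^k ⟨A(u₀∧uᵢ), u₀∧uᵢ⟩ > c. -/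
open scoped RealInnerProductSpace

/-- A linear function on the integral points of a box slice controls it on the real points,
for sorted weights. -/
lemma lt_sum_of_forall_nat_of_sorted {w₀ w₁ w₂ x₀ x₁ x₂ c : ℝ} {D₀ D₁ D₂ k : ℕ}
    (h₀₁ : w₀ ≤ w₁) (h₁₂ : w₁ ≤ w₂)
    (hx₁ : 0 ≤ x₁) (hx₂ : 0 ≤ x₂)
    (hD₀ : x₀ ≤ D₀) (hD₁ : x₁ ≤ D₁) (hD₂ : x₂ ≤ D₂) (hsum : x₀ + x₁ + x₂ = k)
    (h : ∀ n₀ n₁ n₂ : ℕ, n₀ ≤ D₀ → n₁ ≤ D₁ → n₂ ≤ D₂ → n₀ + n₁ + n₂ = k →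
      c < n₀ * w₀ + n₁ * w₁ + n₂ * w₂) :
    c < x₀ * w₀ + x₁ * w₁ + x₂ * w₂ := by
  have hk : k ≤ D₀ + D₁ + D₂ := by
    have : (k : ℝ) ≤ ((D₀ + D₁ + D₂ : ℕ) : ℝ) := by push_cast; linarith
    exact_mod_cast this
  obtain ⟨n₀, n₁, n₂, hn₀, hn₁, hn₂, hn, e₀, e₁⟩ : ∃ n₀ n₁ n₂ : ℕ, n₀ ≤ D₀ ∧ n₁ ≤ D₁ ∧
      n₂ ≤ D₂ ∧ n₀ + n₁ + n₂ = k ∧ (n₀ = k ∨ n₀ = D₀) ∧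
      (n₀ + n₁ = k ∨ n₀ + n₁ = D₀ + D₁) := by
    refine ⟨min D₀ k, min D₁ (k - min D₀ k), k - min D₀ k - min D₁ (k - min D₀ k), ?_⟩
    omega
  have hlt := h n₀ n₁ n₂ hn₀ hn₁ hn₂ hn
  have hn' : (n₀ : ℝ) + n₁ + n₂ = k := by exact_mod_cast hn
  have g₀ : x₀ ≤ n₀ := by
    rcases e₀ with e | e
    · rw [e]; linarith
    · rw [e]; exact hD₀
  have g₁ : x₀ + x₁ ≤ (n₀ : ℝ) + n₁ := by
    rcases e₁ with e | e
    · have : (n₀ : ℝ) + n₁ = k := by exact_mod_cast e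
      linarith
    · have : (n₀ : ℝ) + n₁ = D₀ + D₁ := by exact_mod_cast e
      linarith
  have hx : x₂ = n₀ + n₁ + n₂ - x₀ - x₁ := by linarith
  subst hx
  nlinarith [mul_nonneg (sub_nonneg.2 h₀₁) (sub_nonneg.2 g₀),
    mul_nonneg (sub_nonneg.2 h₁₂) (sub_nonneg.2 g₁)]

lemma lt_sum_of_forall_nat {w x : Fin 3 → ℝ} {c : ℝ} {D : Fin 3 → ℕ} {k : ℕ}
    (hx : ∀ j, 0 ≤ x j) (hD : ∀ j, x j ≤ D j) (hsum : x 0 + x 1 + x 2 = k)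
    (h : ∀ n : Fin 3 → ℕ, (∀ j, n j ≤ D j) → n 0 + n 1 + n 2 = k →
      c < n 0 * w 0 + n 1 * w 1 + n 2 * w 2) :
    c < x 0 * w 0 + x 1 * w 1 + x 2 * w 2 := by
  have h' : ∀ n₀ n₁ n₂ : ℕ, n₀ ≤ D 0 → n₁ ≤ D 1 → n₂ ≤ D 2 → n₀ + n₁ + n₂ = k →
      c < n₀ * w 0 + n₁ * w 1 + n₂ * w 2 := fun n₀ n₁ n₂ h₀ h₁ h₂ hk => by
    simpa using h ![n₀, n₁, n₂] (by intro j; fin_cases j <;> simpa) (by simpa using hk)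
  rcases le_total (w 0) (w 1) with h₀₁ | h₀₁ <;> rcases le_total (w 1) (w 2) with h₁₂ | h₁₂ <;>
    rcases le_total (w 0) (w 2) with h₀₂ | h₀₂
  · exact lt_sum_of_forall_nat_of_sorted h₀₁ h₁₂ (hx 1) (hx 2) (hD 0) (hD 1) (hD 2) hsum h'
  · exact lt_sum_of_forall_nat_of_sorted h₀₁ h₁₂ (hx 1) (hx 2) (hD 0) (hD 1) (hD 2) hsum h'
  · have := lt_sum_of_forall_nat_of_sorted (c := c) (k := k) h₀₂ h₁₂ (hx 2) (hx 1)
      (hD 0) (hD 2) (hD 1) (by linarith)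
      (fun a b d ha hb hd hk => by linarith [h' a d b ha hd hb (by omega)])
    linarith
  · have := lt_sum_of_forall_nat_of_sorted (c := c) (k := k) h₀₂ h₀₁ (hx 0) (hx 1)
      (hD 2) (hD 0) (hD 1) (by linarith)
      (fun a b d ha hb hd hk => by linarith [h' b d a hb hd ha (by omega)])
    linarith
  · have := lt_sum_of_forall_nat_of_sorted (c := c) (k := k) h₀₁ h₀₂ (hx 0) (hx 2)
      (hD 1) (hD 0) (hD 2) (by linarith)
      (fun a b d ha hb hd hk => by linarith [h' b a d hb ha hd (by omega)])
    linarith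
  · have := lt_sum_of_forall_nat_of_sorted (c := c) (k := k) h₁₂ h₀₂ (hx 2) (hx 0)
      (hD 1) (hD 2) (hD 0) (by linarith)
      (fun a b d ha hb hd hk => by linarith [h' d a b hd ha hb (by omega)])
    linarith
  · have := lt_sum_of_forall_nat_of_sorted (c := c) (k := k) h₁₂ h₀₁ (hx 1) (hx 0)
      (hD 2) (hD 1) (hD 0) (by linarith)
      (fun a b d ha hb hd hk => by linarith [h' d b a hd hb ha (by omega)])
    linarith
  · have := lt_sum_of_forall_nat_of_sorted (c := c) (k := k) h₁₂ h₀₁ (hx 1) (hx 0)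
      (hD 2) (hD 1) (hD 0) (by linarith)
      (fun a b d ha hb hd hk => by linarith [h' d b a hd hb ha (by omega)])
    linarith

/-- Finitely many pairwise compatible lower and upper bounds have a common solution. -/
lemma exists_forall_le_and_le {ι : Type*} [Finite ι] [Nonempty ι] {L U : ι → ℝ}
    (h : ∀ i j, L i ≤ U j) : ∃ r, ∀ i, L i ≤ r ∧ r ≤ U i := by
  obtain ⟨i, hi⟩ := Finite.exists_max L
  exact ⟨L i, fun j => ⟨hi j, h i j⟩⟩

/-- The relations between `t i = ‖πᵢ u‖²`, `p j = ∑ₘ ‖πⱼ yₘ‖²` and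
`σ i j = ∑ₘ ⟪πᵢ u, yₘ⟫ ⟪πⱼ u, yₘ⟫` for a family `y` of vectors orthogonal to `u`. -/
structure FrameData (t p : Fin 3 → ℝ) (σ : Fin 3 → Fin 3 → ℝ) : Prop where
  nonneg : ∀ j, 0 ≤ p j
  symm : ∀ i j, σ i j = σ j i
  row : ∀ i, σ i 0 + σ i 1 + σ i 2 = 0
  diag_nonneg : ∀ i, 0 ≤ σ i i
  two_mul_le : ∀ i j, 2 * σ i j ≤ t i * p j + t j * p i
  quad : ∀ i j, 2 * (t i * t j * σ i j) ≤ t j ^ 2 * σ i i + t i ^ 2 * σ j j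
  zero : ∀ i j, t i = 0 → σ i j = 0

/-- The scalar inequality behind `FrameData.cross`, with `A`, `B`, `C` the diagonal entries. -/
lemma cross_aux {a b e A B C s P Q R x : ℝ} (ha : 0 < a) (hb : 0 < b) (he : 0 < e)
    (hsum : a + b + e = 1) (hC : C = A + B + 2 * s) (hCle : C ≤ e - e ^ 2)
    (hR : R = e - e ^ 2 - C) (hx : x = - (b * e) + (B + s))
    (hP : B ≤ b * P) (hQ : R ≤ e * Q) (hquad : 2 * (a * b * s) ≤ b ^ 2 * A + a ^ 2 * B) :
    s + x ≤ a * P + b * Q := by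
  have hP' : a * e * (a * B) ≤ a * e * (a * (b * P)) := by gcongr
  have hQ' : a * b * (b * R) ≤ a * b * (b * (e * Q)) := by gcongr
  have key : 0 ≤ a * (b * e * A + a * e * B + a * b * C) + a * b * (b * e - C) := by
    rcases le_total (a * b * e) (b * e * A + a * e * B + a * b * C) with hT | hT
    · have h₁ := mul_le_mul_of_nonneg_left hT ha.le
      have h₂ : a * b * C ≤ a * b * (e - e ^ 2) := by gcongr
      have h₃ : e - e ^ 2 = e * (a + b) := by rw [show a + b = 1 - e by linarith]; ring
      rw [h₃] at h₂
      linarith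
    · have h₁ := mul_le_mul_of_nonneg_left hT hb.le
      have h₂ : 0 ≤ e * ((a + b) * (b * A + a * B) - a * b * C) := by
        refine mul_nonneg he.le ?_
        rw [hC]
        linarith
      have h₃ : a * b * C * (a + b + e) = a * b * C := by rw [hsum, mul_one]
      linarith
  have hpos : 0 < a * b * e := by positivity
  refine le_of_mul_le_mul_left ?_ hpos
  obtain rfl : s = (C - A - B) / 2 := by linarith
  subst hx hR
  obtain rfl : a = 1 - b - e := by linarith
  linarith

namespace FrameData

variable {t p q : Fin 3 → ℝ} {σ ρ : Fin 3 → Fin 3 → ℝ}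

lemma row_perm (h : FrameData t p σ) {i j k : Fin 3} (hij : i ≠ j) (hjk : j ≠ k) (hik : i ≠ k)
    (l : Fin 3) : σ l i + σ l j + σ l k = 0 := by
  have := h.row l
  fin_cases i <;> fin_cases j <;> fin_cases k <;> simp at * <;> linarith

lemma cross (h : FrameData t p σ) (h' : FrameData t q ρ) (ht : ∀ i, 0 ≤ t i)
    (htsum : t 0 + t 1 + t 2 = 1)
    (hρ : ∀ i j, σ i j + ρ i j = (if i = j then t i else 0) - t i * t j)
    {i j k : Fin 3} (hij : i ≠ j) (hjk : j ≠ k) (hik : i ≠ k) :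
    σ i j + ρ j k ≤ t i * p j + t j * q k := by
  have hs : t i + t j + t k = 1 := by
    rw [← htsum]
    fin_cases i <;> fin_cases j <;> fin_cases k <;> simp at * <;> ring
  have hp := mul_nonneg (ht i) (h.nonneg j)
  have hq := mul_nonneg (ht j) (h'.nonneg k)
  have ri := h.row_perm hij hjk hik i
  have rj := h.row_perm hij hjk hik j
  have rk := h.row_perm hij hjk hik k
  have ri' := h'.row_perm hij hjk hik i
  have rj' := h'.row_perm hij hjk hik j
  have dj := h.diag_nonneg j
  have dj' := h'.diag_nonneg j
  have sij := h.symm i j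
  have sik := h.symm i k
  have sjk := h.symm j k
  have sij' := h'.symm i j
  rcases (ht j).eq_or_lt with zj | pj
  · have := h'.zero j k zj.symm
    have := h.zero j i zj.symm
    linarith
  rcases (ht i).eq_or_lt with zi | pi
  · have := h.zero i j zi.symm
    have := h'.zero i j zi.symm
    linarith
  rcases (ht k).eq_or_lt with zk | pk
  · have := h.zero k j zk.symm
    have := h'.zero k j zk.symm
    have := h'.symm j k
    linarith
  have e₁ := hρ k k
  have e₂ := hρ j k
  have dk' := h'.diag_nonneg k
  have b₁ := h.two_mul_le j j
  have b₂ := h'.two_mul_le k k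
  simp only [if_true, if_neg hjk] at e₁ e₂
  exact cross_aux (A := σ i i) (B := σ j j) (C := σ k k) (R := ρ k k) pi pj pk hs
    (by linarith) (by linarith) (by linarith) (by linarith) (by linarith) (by linarith)
    (h.quad i j)

lemma col_le (h : FrameData t p σ) {i j k : Fin 3} (hij : i ≠ j) (hjk : j ≠ k) (hik : i ≠ k)
    (ht : ∀ i, 0 ≤ t i) : σ i j + σ k j ≤ t i * p j + t k * p j := by
  linarith [h.row_perm hij hjk hik j, h.diag_nonneg j, h.symm i j, h.symm k j,
    mul_nonneg (ht i) (h.nonneg j), mul_nonneg (ht k) (h.nonneg j)]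

lemma row_le (h : FrameData t p σ) {i j k : Fin 3} (hij : i ≠ j) (hjk : j ≠ k) (hik : i ≠ k)
    (ht : ∀ i, 0 ≤ t i) : σ i j + σ i k ≤ t i * p j + t i * p k := by
  linarith [h.row_perm hij hjk hik i, h.diag_nonneg i,
    mul_nonneg (ht i) (h.nonneg j), mul_nonneg (ht i) (h.nonneg k)]

lemma same_le (h : FrameData t p σ) (h' : FrameData t q ρ) (ht : ∀ i, 0 ≤ t i)
    (hρ : ∀ i j, σ i j + ρ i j = (if i = j then t i else 0) - t i * t j)
    {i j : Fin 3} (hij : i ≠ j) : σ i j + ρ i j ≤ t i * p j + t i * q j := by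
  rw [hρ, if_neg hij]
  linarith [mul_nonneg (ht i) (h'.nonneg j), mul_nonneg (ht i) (h.nonneg j),
    mul_nonneg (ht i) (ht j)]

/-- The matrix `t i * p j - σ i j` can be redistributed along the triangle so that its entries
satisfy the box constraints. -/
lemma exists_shift (h : FrameData t p σ) (h' : FrameData t q ρ) (ht : ∀ i, 0 ≤ t i)
    (htsum : t 0 + t 1 + t 2 = 1)
    (hρ : ∀ i j, σ i j + ρ i j = (if i = j then t i else 0) - t i * t j) :
    ∃ r : ℝ, ∀ i : Fin 3,
      (0 ≤ t i * p (i + 1) - σ i (i + 1) + r ∧ 0 ≤ t i * q (i + 1) - ρ i (i + 1) - r) ∧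
      (0 ≤ t (i + 1) * p i - σ (i + 1) i - r ∧ 0 ≤ t (i + 1) * q i - ρ (i + 1) i + r) := by
  have hρ' : ∀ i j, ρ i j + σ i j = (if i = j then t i else 0) - t i * t j :=
    fun i j => by rw [add_comm, hρ]
  have i₁ : ∀ i : Fin 3, i ≠ i + 1 := by decide
  have i₂ : ∀ i : Fin 3, i ≠ i + 2 := by decide
  have i₃ : ∀ i : Fin 3, i + 1 ≠ i + 2 := by decide
  have j₂ : ∀ i : Fin 3, i + 1 + 1 = i + 2 := by decide
  have j₃ : ∀ i : Fin 3, i + 2 + 1 = i := by decide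
  have hcases : ∀ i j : Fin 3, j = i ∨ j = i + 1 ∨ j = i + 2 := by decide
  obtain ⟨r, hr⟩ := exists_forall_le_and_le (ι := Fin 3 ⊕ Fin 3)
    (L := Sum.elim (fun i => σ i (i + 1) - t i * p (i + 1))
      (fun i => ρ (i + 1) i - t (i + 1) * q i))
    (U := Sum.elim (fun i => t i * q (i + 1) - ρ i (i + 1))
      (fun i => t (i + 1) * p i - σ (i + 1) i)) (by
    rintro (i | i) (j | j) <;> rcases hcases i j with rfl | rfl | rfl <;>
      simp only [Sum.elim_inl, Sum.elim_inr, j₂, j₃]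
    · linarith [h.same_le h' ht hρ (i₁ j)]
    · linarith [h.cross h' ht htsum hρ (i₁ i) (i₃ i) (i₂ i)]
    · linarith [h'.cross h ht htsum hρ' (i₂ i).symm (i₁ i) (i₃ i).symm]
    · linarith [h.two_mul_le j (j + 1), h.symm j (j + 1)]
    · linarith [h.col_le (i₁ i) (i₃ i) (i₂ i) ht]
    · linarith [h.row_le (i₁ i) (i₃ i) (i₂ i) ht]
    · linarith [h'.two_mul_le j (j + 1), h'.symm j (j + 1)]
    · linarith [h'.row_le (i₁ i).symm (i₂ i) (i₃ i) ht]
    · linarith [h'.col_le (i₁ i).symm (i₂ i) (i₃ i) ht]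
    · linarith [h.same_le h' ht hρ (i₁ j).symm]
    · linarith [h.cross h' ht htsum hρ (i₃ i).symm (i₁ i).symm (i₂ i).symm]
    · linarith [h'.cross h ht htsum hρ' (i₁ i).symm (i₂ i) (i₃ i)])
  simp only [Sum.forall, Sum.elim_inl, Sum.elim_inr] at hr
  exact ⟨r, fun i => ⟨⟨by linarith [(hr.1 i).1], by linarith [(hr.1 i).2]⟩,
    by linarith [(hr.2 i).2], by linarith [(hr.2 i).1]⟩⟩

end FrameData

namespace FrameData

variable {t p q : Fin 3 → ℝ} {σ ρ : Fin 3 → Fin 3 → ℝ}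

lemma exists_row_box (h : FrameData t p σ) (h' : FrameData t q ρ) (ht : ∀ i, 0 ≤ t i)
    (htsum : t 0 + t 1 + t 2 = 1)
    (hρ : ∀ i j, σ i j + ρ i j = (if i = j then t i else 0) - t i * t j)
    {d : Fin 3 → ℕ} (hd : ∀ j, p j + q j + t j = d j) :
    ∃ P : Fin 3 → Fin 3 → ℝ, (∀ i j, 0 ≤ P i j) ∧ (∀ i j, i ≠ j → P i j ≤ t i * d j) ∧
      (∀ i, P i i ≤ t i * (d i - 1)) ∧
      (∀ i, P i 0 + P i 1 + P i 2 = t i * (p 0 + p 1 + p 2)) ∧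
      (∀ l : Fin 3 → Fin 3 → ℝ, (∀ i j, i ≠ j → 0 < d i → 0 < d j → l i j = l j i) →
        ∑ i, ∑ j, l i j * P i j = ∑ i, ∑ j, l i j * (t i * p j - σ i j)) := by
  obtain ⟨r, hr⟩ := h.exists_shift h' ht htsum hρ
  have hbox : ∀ i j, i ≠ j → t i * p j - σ i j + (t i * q j - ρ i j) = t i * d j := by
    intro i j hij
    have := hρ i j
    rw [if_neg hij] at this
    rw [← hd]
    linarith
  have hdiag : ∀ i, t i * p i - σ i i + (t i * q i - ρ i i) = t i * (d i - 1) := by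
    intro i
    have := hρ i i
    rw [if_pos rfl] at this
    rw [← hd]
    linarith
  have hdiag_nonneg : ∀ i, 0 ≤ t i * p i - σ i i := fun i => by linarith [h.two_mul_le i i]
  have hdiag_nonneg' : ∀ i, 0 ≤ t i * q i - ρ i i := fun i => by linarith [h'.two_mul_le i i]
  have hr₀ := hr 0
  have hr₁ := hr 1
  have hr₂ := hr 2
  simp only [Fin.isValue, Fin.reduceAdd, zero_add] at hr₀ hr₁ hr₂
  obtain ⟨⟨a₁, a₂⟩, a₃, a₄⟩ := hr₀
  obtain ⟨⟨b₁, b₂⟩, b₃, b₄⟩ := hr₁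
  obtain ⟨⟨c₁, c₂⟩, c₃, c₄⟩ := hr₂
  have hzero : ∀ j, d j = 0 → t j = 0 ∧ p j = 0 ∧ q j = 0 := by
    intro j hj
    have := hd j
    rw [hj, Nat.cast_zero] at this
    have := ht j
    have := h.nonneg j
    have := h'.nonneg j
    refine ⟨?_, ?_, ?_⟩ <;> linarith
  refine ⟨fun i j => t i * p j - σ i j + ![![0, r, -r], ![-r, 0, r], ![r, -r, 0]] i j,
    ?_, ?_, ?_, ?_, ?_⟩
  · intro i j
    have := hdiag_nonneg i
    fin_cases i <;> fin_cases j <;> simp at * <;> linarith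
  · intro i j hij
    rw [← hbox i j hij]
    fin_cases i <;> fin_cases j <;> simp at * <;> linarith
  · intro i
    rw [← hdiag i]
    have := hdiag_nonneg' i
    fin_cases i <;> simp at * <;> linarith
  · intro i
    have := h.row i
    fin_cases i <;> simp at * <;> linarith
  · intro l hl
    have key : r * (l 0 1 + l 1 2 + l 2 0 - l 1 0 - l 2 1 - l 0 2) = 0 := by
      by_cases hpos : ∀ i, 0 < d i
      · rw [hl 0 1 (by decide) (hpos _) (hpos _), hl 1 2 (by decide) (hpos _) (hpos _),
          hl 2 0 (by decide) (hpos _) (hpos _)]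
        ring
      · push Not at hpos
        obtain ⟨j, hj⟩ := hpos
        obtain ⟨tj, pj, qj⟩ := hzero j (by omega)
        have σj : ∀ i, σ i j = 0 := fun i => by rw [h.symm, h.zero j i tj]
        have ρj : ∀ i, ρ i j = 0 := fun i => by rw [h'.symm, h'.zero j i tj]
        have r0 : r = 0 := by
          fin_cases j <;> simp only [Fin.zero_eta, Fin.mk_one, Fin.reduceFinMk] at * <;>
            simp only [tj, pj, qj, σj, ρj, mul_zero, zero_mul] at * <;> linarith
        rw [r0, zero_mul]
    simp [Fin.sum_univ_three]
    linarith

lemma lt_sum (h : FrameData t p σ) (h' : FrameData t q ρ) (ht : ∀ i, 0 ≤ t i)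
    (htsum : t 0 + t 1 + t 2 = 1)
    (hρ : ∀ i j, σ i j + ρ i j = (if i = j then t i else 0) - t i * t j)
    {d : Fin 3 → ℕ} (hd : ∀ j, p j + q j + t j = d j)
    {k : ℕ} (hk : p 0 + p 1 + p 2 = k) {l : Fin 3 → Fin 3 → ℝ}
    (hl : ∀ i j, i ≠ j → 0 < d i → 0 < d j → l i j = l j i) {c : ℝ}
    (hcomb : ∀ i : Fin 3, ∀ n : Fin 3 → ℕ, (∀ j, j ≠ i → n j ≤ d j) → n i + 1 ≤ d i →
      n 0 + n 1 + n 2 = k → c < n 0 * l i 0 + n 1 * l i 1 + n 2 * l i 2) :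
    c < ∑ i, ∑ j, l i j * (t i * p j - σ i j) := by
  obtain ⟨P, hP₀, hP, hPdiag, hrow, hsum⟩ := h.exists_row_box h' ht htsum hρ hd
  rw [← hsum l hl]
  have hlt : ∀ i, 0 < t i → t i * c < ∑ j, l i j * P i j := by
    intro i hi
    have hdi : 0 < d i := by
      have : (0 : ℝ) < d i := by rw [← hd]; linarith [h.nonneg i, h'.nonneg i]
      exact_mod_cast this
    have := lt_sum_of_forall_nat (w := l i) (x := fun j => P i j / t i) (c := c)
      (D := fun j => if j = i then d i - 1 else d j) (k := k)
      (fun j => div_nonneg (hP₀ i j) hi.le) ?_ ?_ ?_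
    · have := mul_lt_mul_of_pos_left this hi
      refine this.trans_eq ?_
      rw [Fin.sum_univ_three]
      field_simp
    · intro j
      rw [div_le_iff₀' hi]
      split_ifs with hj
      · subst hj
        rw [Nat.cast_pred hdi]
        exact hPdiag j
      · exact hP i j (Ne.symm hj)
    · rw [← add_div, ← add_div, hrow, hk, mul_div_cancel_left₀ _ hi.ne']
    · intro n hn hnk
      refine hcomb i n (fun j hj => by simpa [hj] using hn j) ?_ hnk
      have := hn i
      simp only [if_true] at this
      omega
  have hle : ∀ i, t i * c ≤ ∑ j, l i j * P i j := by
    intro i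
    rcases (ht i).eq_or_lt with hi | hi
    · have hz : ∀ j, P i j = 0 := fun j => by
        refine le_antisymm ?_ (hP₀ i j)
        rcases eq_or_ne i j with rfl | hij
        · simpa [← hi] using hPdiag i
        · simpa [← hi] using hP i j hij
      simp [hz, ← hi]
    · exact (hlt i hi).le
  obtain ⟨i, hi⟩ : ∃ i, 0 < t i := by
    by_contra! hneg
    linarith [hneg 0, hneg 1, hneg 2]
  calc c = ∑ i, t i * c := by rw [← Finset.sum_mul, Fin.sum_univ_three, htsum, one_mul]
    _ < _ := Finset.sum_lt_sum (fun i _ => hle i) ⟨i, Finset.mem_univ i, hlt i hi⟩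

end FrameData

lemma eigenvalue_symm {V W : Type*} [NormedAddCommGroup V] [InnerProductSpace ℝ V]
    [NormedAddCommGroup W] [InnerProductSpace ℝ W]
    {Vs : Fin 3 → Submodule ℝ V} {wedge : V →ₗ[ℝ] V →ₗ[ℝ] W}
    (hinner : ∀ x y z u : V,
      ⟪wedge x y, wedge z u⟫ = ⟪x, z⟫ * ⟪y, u⟫ - ⟪x, u⟫ * ⟪y, z⟫)
    (horth : ∀ i j, i ≠ j → ∀ x ∈ Vs i, ∀ y ∈ Vs j, ⟪x, y⟫ = 0)
    {A : W →ₗ[ℝ] W} (hA : ∀ x y : W, ⟪A x, y⟫ = ⟪x, A y⟫) {l : Fin 3 → Fin 3 → ℝ}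
    (heig : ∀ i j, ∀ x ∈ Vs i, ∀ y ∈ Vs j, A (wedge x y) = l i j • wedge x y) {i j : Fin 3}
    (hij : i ≠ j) (hi : 0 < Module.finrank ℝ (Vs i)) (hj : 0 < Module.finrank ℝ (Vs j)) :
    l i j = l j i := by
  have := Module.nontrivial_of_finrank_pos hi
  have := Module.nontrivial_of_finrank_pos hj
  obtain ⟨x, hx⟩ := exists_ne (0 : Vs i)
  obtain ⟨y, hy⟩ := exists_ne (0 : Vs j)
  have h := hA (wedge x y) (wedge y x)
  rw [heig i j x x.2 y y.2, heig j i y y.2 x x.2, real_inner_smul_left, real_inner_smul_right,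
    hinner, horth i j hij x x.2 y y.2, zero_mul, zero_sub] at h
  refine mul_right_cancel₀ (neg_ne_zero.2 (mul_ne_zero ?_ ?_)) h
  · simpa using hx
  · simpa using hy

section Geometry

variable {V : Type*} [NormedAddCommGroup V] [InnerProductSpace ℝ V] [FiniteDimensional ℝ V]

lemma sum_norm_sq_starProjection {ι : Type*} [Fintype ι] (b : OrthonormalBasis ι ℝ V)
    (U : Submodule ℝ V) : ∑ i, ‖U.starProjection (b i)‖ ^ 2 = Module.finrank ℝ U := by
  have h : ∀ x, ‖U.starProjection x‖ ^ 2 =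
      ∑ j, ⟪x, (stdOrthonormalBasis ℝ U j : V)⟫ ^ 2 := by
    intro x
    rw [Submodule.starProjection_apply, Submodule.norm_coe,
      ← (stdOrthonormalBasis ℝ U).sum_sq_norm_inner_left]
    refine Finset.sum_congr rfl fun j _ => ?_
    rw [Real.norm_eq_abs, sq_abs, Submodule.inner_orthogonalProjectionOnto_eq_of_mem_right]
  simp_rw [h]
  rw [Finset.sum_comm]
  have h' : ∀ j, ∑ i, ⟪b i, (stdOrthonormalBasis ℝ U j : V)⟫ ^ 2 = 1 := by
    intro j
    have := b.sum_sq_norm_inner_right (stdOrthonormalBasis ℝ U j : V)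
    simp only [Real.norm_eq_abs, sq_abs] at this
    rw [this, Submodule.norm_coe, (stdOrthonormalBasis ℝ U).orthonormal.1 j, one_pow]
  simp [h']

variable {Vs : Fin 3 → Submodule ℝ V}

lemma starProjection_add (horth : ∀ i j, i ≠ j → ∀ x ∈ Vs i, ∀ y ∈ Vs j, ⟪x, y⟫ = 0)
    (hsum : Vs 0 ⊔ Vs 1 ⊔ Vs 2 = ⊤) (x : V) :
    (Vs 0).starProjection x + (Vs 1).starProjection x + (Vs 2).starProjection x = x := by
  have hx : x ∈ Vs 0 ⊔ Vs 1 ⊔ Vs 2 := hsum ▸ Submodule.mem_top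
  obtain ⟨w, hw, z, hz, rfl⟩ := Submodule.mem_sup.1 hx
  obtain ⟨v, hv, y, hy, rfl⟩ := Submodule.mem_sup.1 hw
  have h0 : ∀ i j, i ≠ j → ∀ v ∈ Vs j, (Vs i).starProjection v = 0 := fun i j hij v hv => by
    rw [Submodule.starProjection_apply_eq_zero_iff, Submodule.mem_orthogonal]
    exact fun u hu => horth i j hij u hu v hv
  have h1 : ∀ i, ∀ v ∈ Vs i, (Vs i).starProjection v = v := fun i v hv =>
    Submodule.starProjection_eq_self_iff.2 hv
  simp only [map_add]
  rw [h1 0 v hv, h1 1 y hy, h1 2 z hz, h0 0 1 (by decide) y hy, h0 0 2 (by decide) z hz,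
    h0 1 0 (by decide) v hv, h0 1 2 (by decide) z hz, h0 2 0 (by decide) v hv,
    h0 2 1 (by decide) y hy]
  abel

lemma frameData (horth : ∀ i j, i ≠ j → ∀ x ∈ Vs i, ∀ y ∈ Vs j, ⟪x, y⟫ = 0)
    (hsum : Vs 0 ⊔ Vs 1 ⊔ Vs 2 = ⊤) {ι : Type*} [Fintype ι] {u : V} {y : ι → V}
    (huy : ∀ m, ⟪u, y m⟫ = 0) :
    FrameData (fun i => ‖(Vs i).starProjection u‖ ^ 2)
      (fun j => ∑ m, ‖(Vs j).starProjection (y m)‖ ^ 2)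
      (fun i j => ∑ m, ⟪(Vs i).starProjection u, y m⟫ * ⟪(Vs j).starProjection u, y m⟫) where
  nonneg j := by positivity
  symm i j := by simp_rw [mul_comm]
  row i := by
    simp_rw [← Finset.sum_add_distrib, ← mul_add, ← inner_add_left,
      starProjection_add horth hsum, huy]
    simp
  diag_nonneg i := Finset.sum_nonneg fun m _ => mul_self_nonneg _
  two_mul_le i j := by
    simp_rw [Finset.mul_sum, ← Finset.sum_add_distrib]
    refine Finset.sum_le_sum fun m _ => ?_
    have hle : ∀ i, |⟪(Vs i).starProjection u, y m⟫| ≤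
        ‖(Vs i).starProjection u‖ * ‖(Vs i).starProjection (y m)‖ := fun i => by
      rw [← Submodule.starProjection_eq_self_iff.2 ((Vs i).starProjection_apply_mem u),
        Submodule.inner_starProjection_left_eq_right,
        Submodule.starProjection_eq_self_iff.2 ((Vs i).starProjection_apply_mem u)]
      exact abs_real_inner_le_norm _ _
    have h₁ := mul_le_mul (hle i) (hle j) (abs_nonneg _) (by positivity)
    rw [← abs_mul] at h₁
    have h₂ := le_abs_self
      (⟪(Vs i).starProjection u, y m⟫ * ⟪(Vs j).starProjection u, y m⟫)
    nlinarith [sq_nonneg (‖(Vs i).starProjection u‖ * ‖(Vs j).starProjection (y m)‖ -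
      ‖(Vs j).starProjection u‖ * ‖(Vs i).starProjection (y m)‖)]
  quad i j := by
    simp_rw [Finset.mul_sum, ← Finset.sum_add_distrib]
    refine Finset.sum_le_sum fun m _ => ?_
    nlinarith [sq_nonneg (‖(Vs j).starProjection u‖ ^ 2 * ⟪(Vs i).starProjection u, y m⟫ -
      ‖(Vs i).starProjection u‖ ^ 2 * ⟪(Vs j).starProjection u, y m⟫)]
  zero i j hi := by
    rw [sq_eq_zero_iff, norm_eq_zero] at hi
    simp [hi]

lemma inner_starProjection_self (U : Submodule ℝ V) (x : V) :
    ⟪U.starProjection x, x⟫ = ‖U.starProjection x‖ ^ 2 := by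
  conv_lhs => rw [← Submodule.starProjection_eq_self_iff.2 (U.starProjection_apply_mem x)]
  rw [Submodule.inner_starProjection_left_eq_right, real_inner_self_eq_norm_sq]

lemma inner_map_wedge {W : Type*} [NormedAddCommGroup W] [InnerProductSpace ℝ W]
    {wedge : V →ₗ[ℝ] V →ₗ[ℝ] W}
    (hinner : ∀ x y z u : V,
      ⟪wedge x y, wedge z u⟫ = ⟪x, z⟫ * ⟪y, u⟫ - ⟪x, u⟫ * ⟪y, z⟫)
    (horth : ∀ i j, i ≠ j → ∀ x ∈ Vs i, ∀ y ∈ Vs j, ⟪x, y⟫ = 0)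
    (hsum : Vs 0 ⊔ Vs 1 ⊔ Vs 2 = ⊤) {A : W →ₗ[ℝ] W} {l : Fin 3 → Fin 3 → ℝ}
    (heig : ∀ i j, ∀ x ∈ Vs i, ∀ y ∈ Vs j, A (wedge x y) = l i j • wedge x y) (u y : V) :
    ⟪A (wedge u y), wedge u y⟫ = ∑ i, ∑ j, l i j *
      (‖(Vs i).starProjection u‖ ^ 2 * ‖(Vs j).starProjection y‖ ^ 2 -
        ⟪(Vs i).starProjection u, y⟫ * ⟪(Vs j).starProjection u, y⟫) := by
  have hdecomp : ∀ x, ∑ i, (Vs i).starProjection x = x := fun x => by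
    rw [Fin.sum_univ_three, starProjection_add horth hsum]
  have hA : A (wedge u y) = ∑ i, ∑ j, l i j •
      wedge ((Vs i).starProjection u) ((Vs j).starProjection y) := by
    conv_lhs => rw [← hdecomp u, ← hdecomp y]
    simp only [map_sum, LinearMap.sum_apply]
    rw [Finset.sum_comm]
    refine Finset.sum_congr rfl fun i _ => Finset.sum_congr rfl fun j _ => ?_
    exact heig i j _ ((Vs i).starProjection_apply_mem u) _ ((Vs j).starProjection_apply_mem y)
  rw [hA, sum_inner]
  refine Finset.sum_congr rfl fun i _ => ?_
  rw [sum_inner]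
  refine Finset.sum_congr rfl fun j _ => ?_
  rw [real_inner_smul_left, hinner, inner_starProjection_self, inner_starProjection_self,
    Submodule.inner_starProjection_left_eq_right (Vs j) y u,
    real_inner_comm _ y]

end Geometry

/-- The Reiser–Wraith linear algebra lemma: if a self-adjoint operator A on Λ²V has
the subspaces Vᵢ∧Vⱼ of an orthogonal splitting V = V₁ ⊕ V₂ ⊕ V₃ as eigenspaces with
eigenvalues λᵢⱼ, and all admissible eigenvalue sums n_{i1}λ_{i1}+n_{i2}λ_{i2}+n_{i3}λ_{i3}
with n_{i1}+n_{i2}+n_{i3} = k exceed c, then every partial trace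
∑ᵢ ⟨A(u₀∧uᵢ), u₀∧uᵢ⟩ over an orthonormal (k+1)-frame exceeds c. -/
theorem stmt_17
    {V W : Type*} [NormedAddCommGroup V] [InnerProductSpace ℝ V] [FiniteDimensional ℝ V]
    [NormedAddCommGroup W] [InnerProductSpace ℝ W]
    (wedge : V →ₗ[ℝ] V →ₗ[ℝ] W)
    (hspan : Submodule.span ℝ {w : W | ∃ x y, wedge x y = w} = ⊤)
    (hinner : ∀ x y z u : V,
      ⟪wedge x y, wedge z u⟫ = ⟪x, z⟫ * ⟪y, u⟫ - ⟪x, u⟫ * ⟪y, z⟫)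
    (Vs : Fin 3 → Submodule ℝ V)
    (horth : ∀ i j, i ≠ j → ∀ x ∈ Vs i, ∀ y ∈ Vs j, ⟪x, y⟫ = 0)
    (hsum : Vs 0 ⊔ Vs 1 ⊔ Vs 2 = ⊤)
    (A : W →ₗ[ℝ] W) (hA : ∀ x y : W, ⟪A x, y⟫ = ⟪x, A y⟫)
    (l : Fin 3 → Fin 3 → ℝ)
    (heig : ∀ i j, ∀ x ∈ Vs i, ∀ y ∈ Vs j, A (wedge x y) = l i j • wedge x y)
    (k : ℕ) (hk : k + 1 ≤ Module.finrank ℝ V) (c : ℝ)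
    (hcomb : ∀ i : Fin 3, ∀ nn : Fin 3 → ℕ,
      (∀ j, j ≠ i → nn j ≤ Module.finrank ℝ (Vs j)) →
      nn i + 1 ≤ Module.finrank ℝ (Vs i) →
      nn 0 + nn 1 + nn 2 = k →
      c < (nn 0 : ℝ) * l i 0 + (nn 1 : ℝ) * l i 1 + (nn 2 : ℝ) * l i 2) :
    ∀ u : Fin (k + 1) → V, Orthonormal ℝ u →
      c < ∑ i : Fin k, ⟪A (wedge (u 0) (u i.succ)), wedge (u 0) (u i.succ)⟫ := by
  intro u hu
  obtain ⟨q, hq⟩ := Nat.exists_eq_add_of_le hk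
  obtain ⟨b, hb⟩ : ∃ b : OrthonormalBasis (Fin (k + 1) ⊕ Fin q) ℝ V,
      ∀ i, b (Sum.inl i) = u i := by
    obtain ⟨b, hb⟩ := Orthonormal.exists_orthonormalBasis_extension_of_card_eq (𝕜 := ℝ)
      (ι := Fin (k + 1) ⊕ Fin q) (by simpa using hq) (v := Sum.elim u 0)
      (s := Set.range Sum.inl) (by
        rw [orthonormal_iff_ite] at hu ⊢
        rintro ⟨_, i, rfl⟩ ⟨_, j, rfl⟩
        simpa [Subtype.ext_iff] using hu i j)
    exact ⟨b, fun i => hb _ ⟨i, rfl⟩⟩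
  have hsplit : ∀ f : V → ℝ, ∑ i, f (b i) =
      f (u 0) + ∑ i : Fin k, f (u i.succ) + ∑ i : Fin q, f (b (Sum.inr i)) := fun f => by
    simp [Fin.sum_univ_succ, hb]
  have hy := frameData horth hsum (u := u 0) (y := fun m : Fin k => u m.succ)
    fun m => hu.2 (Fin.succ_ne_zero m).symm
  have hz := frameData horth hsum (u := u 0) (y := fun m : Fin q => b (Sum.inr m))
    fun m => by rw [← hb]; exact b.orthonormal.2 (by simp)
  have hnorm : ∀ x : V, ‖(Vs 0).starProjection x‖ ^ 2 + ‖(Vs 1).starProjection x‖ ^ 2 +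
      ‖(Vs 2).starProjection x‖ ^ 2 = ‖x‖ ^ 2 := fun x => by
    simp_rw [← inner_starProjection_self]
    rw [← inner_add_left, ← inner_add_left, starProjection_add horth hsum,
      real_inner_self_eq_norm_sq]
  have key := hy.lt_sum hz (fun i => by positivity) (by simp [hnorm, hu.1])
    (fun i j => ?_) (d := fun j => Module.finrank ℝ (Vs j)) (fun j => ?_) (k := k) ?_
    (fun i j => eigenvalue_symm hinner horth hA heig) hcomb
  · refine key.trans_eq ?_
    simp_rw [inner_map_wedge hinner horth hsum heig]
    symm
    rw [Finset.sum_comm]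
    refine Finset.sum_congr rfl fun i _ => ?_
    rw [Finset.sum_comm]
    refine Finset.sum_congr rfl fun j _ => ?_
    rw [← Finset.mul_sum, Finset.sum_sub_distrib, Finset.mul_sum]
  · have h := hsplit fun x =>
      ⟪(Vs i).starProjection (u 0), x⟫ * ⟪(Vs j).starProjection (u 0), x⟫
    simp only [inner_starProjection_self] at h
    have h' : ∑ m, ⟪(Vs i).starProjection (u 0), b m⟫ * ⟪(Vs j).starProjection (u 0), b m⟫ =
        if i = j then ‖(Vs i).starProjection (u 0)‖ ^ 2 else 0 := by
      simp_rw [real_inner_comm (b _) ((Vs j).starProjection (u 0))]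
      rw [b.sum_inner_mul_inner]
      split_ifs with hij
      · rw [hij, real_inner_self_eq_norm_sq]
      · exact horth i j hij _ ((Vs i).starProjection_apply_mem _) _
          ((Vs j).starProjection_apply_mem _)
    linarith
  · have h := hsplit fun x => ‖(Vs j).starProjection x‖ ^ 2
    rw [sum_norm_sq_starProjection] at h
    linarith
  · simp_rw [← Finset.sum_add_distrib, hnorm, hu.1]
    simp
end
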